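/- Let C be an accessible category that has all directed colimits and all of whose morphisms are monomorphisms. Then there is a universal abstract elementary class L and an essentially surjective faithful functor F : L → C preserving directed colimits. -/

import Mathlib

universe u v w

open CategoryTheory CategoryTheory.Limits Cardinal FirstOrder

noncomputable section

namespace Paper

/-! ## General category-theoretic notions -/

/-- A preorder is `κ`-directed if every subset of cardinality `< κ` has an upper bound. -/
def CardDirected (κ : Cardinal.{u}) (J : Type u) [Preorder J] : Prop :=
  ∀ S : Set J, #S < κ → ∃ j : J, ∀ s ∈ S, s ≤ j

/-- A bundled preordered index type. -/
structure IndexPoset : Type (u + 1) where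
  J : Type u
  pre : Preorder J

instance (P : IndexPoset.{u}) : Preorder P.J := P.pre

/-- `C` has all `κ`-directed colimits (indexed by `κ`-directed preorders in `Type u`).
For `κ = ℵ₀` these are the usual directed colimits. -/
def HasCardDirectedColimits (κ : Cardinal.{u}) (C : Type v) [Category.{w} C] : Prop :=
  ∀ (J : Type u) [Preorder J], CardDirected κ J → HasColimitsOfShape J C

/-- An object `M` is `κ`-presentable if its hom-functor `C(M,-)` preserves `κ`-directed
colimits, i.e. every morphism from `M` into a `κ`-directed colimit factors essentially
uniquely through some stage of the diagram.  For `κ = ℵ₀` this is `ℵ₀`-presentability. -/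
def IsCardPresentable {C : Type v} [Category.{w} C] (κ : Cardinal.{u}) (M : C) : Prop :=
  ∀ (J : Type u) [Preorder J], CardDirected κ J →
    ∀ (D : J ⥤ C) (c : Cocone D), IsColimit c →
      (∀ f : M ⟶ c.pt, ∃ (j : J) (g : M ⟶ D.obj j), g ≫ c.ι.app j = f) ∧
      (∀ (j : J) (g₁ g₂ : M ⟶ D.obj j), g₁ ≫ c.ι.app j = g₂ ≫ c.ι.app j →
        ∃ (j' : J) (h : j ≤ j'), g₁ ≫ D.map (homOfLE h) = g₂ ≫ D.map (homOfLE h))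

/-- `C` is `κ`-accessible: it has all `κ`-directed colimits and there is a *set* `S`
of `κ`-presentable objects such that every object of `C` is a `κ`-directed colimit
of objects from `S`. -/
def IsCardAccessible (κ : Cardinal.{u}) (C : Type v) [Category.{w} C] : Prop :=
  HasCardDirectedColimits.{u} κ C ∧
    ∃ S : Set C, Small.{u} S ∧ (∀ M ∈ S, IsCardPresentable.{u} κ M) ∧
      ∀ X : C, ∃ (P : IndexPoset.{u}) (D : P.J ⥤ C) (c : Cocone D),
        CardDirected κ P.J ∧ (∀ j, D.obj j ∈ S) ∧ c.pt = X ∧ Nonempty (IsColimit c)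

/-- `C` has all connected limits (limits over small connected index categories). -/
def HasConnectedLimits (C : Type v) [Category.{w} C] : Prop :=
  ∀ (J : Type u) [SmallCategory J], IsConnected J → HasLimitsOfShape J C

/-- A functor preserves directed colimits. -/
def PreservesDirectedColimits {D : Type*} [Category D] {C : Type*} [Category C]
    (F : D ⥤ C) : Prop :=
  ∀ (J : Type u) [Preorder J], IsDirected J (· ≤ ·) → Nonempty J →
    PreservesColimitsOfShape J F

/-- A functor `F : L ⥤ C` is *pullback-full* if for every set-indexed family of
morphisms `f i : B i ⟶ C₀` in `L` and every family `g i : A ⟶ F.obj (B i)` in `C`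
with `F.map (f i) ∘ g i` all equal, the family `g` lifts along `F`. -/
def PullbackFull {L : Type*} [Category L] {C : Type*} [Category C] (F : L ⥤ C) : Prop :=
  ∀ (I : Type u) (B : I → L) (C₀ : L) (f : ∀ i, B i ⟶ C₀) (A : C)
    (g : ∀ i, A ⟶ F.obj (B i)),
    (∀ i j, g i ≫ F.map (f i) = g j ≫ F.map (f j)) →
    ∃ (A' : L) (hA : F.obj A' = A) (gb : ∀ i, A' ⟶ B i),
      ∀ i, F.map (gb i) = eqToHom hA ≫ g i

/-! ## Classes of structures in a finitary vocabulary

A `SetStruct L W` is a `τ`-structure (for the finitary first-order vocabulary `L`)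
whose universe is a small subset of the ambient class `W` of elements.  The
interpretations of function and relation symbols are given as total functions on
tuples from `W` (their values outside the universe are irrelevant junk), so that the
substructure relation can be taken literally. -/

variable (L : FirstOrder.Language.{u, u}) (W : Type (u + 1))

structure SetStruct : Type (u + 1) where
  carrier : Set W
  small : Small.{u} carrier
  fn : ∀ n : ℕ, L.Functions n → (Fin n → W) → W
  rel : ∀ n : ℕ, L.Relations n → (Fin n → W) → Prop
  fn_mem : ∀ (n : ℕ) (f : L.Functions n) (x : Fin n → W),
    (∀ i, x i ∈ carrier) → fn n f x ∈ carrier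

variable {L W}

theorem SetStruct.ext' {M N : SetStruct L W} (hc : M.carrier = N.carrier)
    (hf : ∀ n f x, M.fn n f x = N.fn n f x)
    (hr : ∀ n r x, M.rel n r x ↔ N.rel n r x) : M = N := by
  rcases M with ⟨c₁, s₁, f₁, r₁, m₁⟩
  rcases N with ⟨c₂, s₂, f₂, r₂, m₂⟩
  dsimp only at hc hf hr
  subst hc
  have hf' : f₁ = f₂ := by funext n f x; exact hf n f x
  have hr' : r₁ = r₂ := by funext n r x; exact propext (hr n r x)
  subst hf'; subst hr'
  rfl

/-- `M` is a substructure of `N`:  the universe of `M` is contained in that of `N` and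
the interpretations of all function and relation symbols agree on tuples from `M`
(in particular relations are both preserved and reflected). -/
def Sub (M N : SetStruct L W) : Prop :=
  M.carrier ⊆ N.carrier ∧
    (∀ (n : ℕ) (f : L.Functions n) (x : Fin n → W),
      (∀ i, x i ∈ M.carrier) → M.fn n f x = N.fn n f x) ∧
    (∀ (n : ℕ) (r : L.Relations n) (x : Fin n → W),
      (∀ i, x i ∈ M.carrier) → (M.rel n r x ↔ N.rel n r x))

theorem Sub.refl (M : SetStruct L W) : Sub M M :=
  ⟨le_refl _, fun _ _ _ _ => rfl, fun _ _ _ _ => Iff.rfl⟩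

theorem Sub.trans {M N P : SetStruct L W} (h₁ : Sub M N) (h₂ : Sub N P) : Sub M P :=
  ⟨h₁.1.trans h₂.1,
   fun n f x hx => (h₁.2.1 n f x hx).trans (h₂.2.1 n f x fun i => h₁.1 (hx i)),
   fun n r x hx => (h₁.2.2 n r x hx).trans (h₂.2.2 n r x fun i => h₁.1 (hx i))⟩

/-- A (substructure) embedding of `τ`-structures: an injective map preserving all
function symbols and preserving and reflecting all relation symbols. -/
structure Emb (M N : SetStruct L W) : Type (u + 1) where
  toFun : M.carrier → N.carrier
  inj : Function.Injective toFun
  map_fn : ∀ (n : ℕ) (f : L.Functions n) (x : Fin n → M.carrier),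
    (toFun ⟨M.fn n f fun i => (x i : W), M.fn_mem n f _ fun i => (x i).2⟩ : W) =
      N.fn n f fun i => (toFun (x i) : W)
  map_rel : ∀ (n : ℕ) (r : L.Relations n) (x : Fin n → M.carrier),
    M.rel n r (fun i => (x i : W)) ↔ N.rel n r fun i => (toFun (x i) : W)

theorem Emb.ext' {M N : SetStruct L W} {e₁ e₂ : Emb M N}
    (h : e₁.toFun = e₂.toFun) : e₁ = e₂ := by
  rcases e₁ with ⟨f₁, i₁, mf₁, mr₁⟩
  rcases e₂ with ⟨f₂, i₂, mf₂, mr₂⟩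
  dsimp only at h
  subst h
  rfl

/-- The identity embedding. -/
def Emb.refl (M : SetStruct L W) : Emb M M where
  toFun := id
  inj := fun _ _ h => h
  map_fn _ _ _ := rfl
  map_rel _ _ _ := Iff.rfl

/-- Composition of embeddings. -/
def Emb.comp {M N P : SetStruct L W} (g : Emb N P) (f : Emb M N) : Emb M P where
  toFun := g.toFun ∘ f.toFun
  inj := g.inj.comp f.inj
  map_fn n φ x := by
    have h1 : f.toFun ⟨M.fn n φ fun i => (x i : W), M.fn_mem n φ _ fun i => (x i).2⟩ =
        ⟨N.fn n φ fun i => (f.toFun (x i) : W), N.fn_mem n φ _ fun i => (f.toFun (x i)).2⟩ :=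
      Subtype.ext (f.map_fn n φ x)
    show (g.toFun (f.toFun _) : W) = _
    rw [h1]
    exact g.map_fn n φ fun i => f.toFun (x i)
  map_rel n r x :=
    (f.map_rel n r x).trans (g.map_rel n r fun i => f.toFun (x i))

/-- The inclusion embedding of a substructure. -/
def Sub.emb {M N : SetStruct L W} (h : Sub M N) : Emb M N where
  toFun x := ⟨(x : W), h.1 x.2⟩
  inj := by
    intro a b hab
    have hv : (a : W) = (b : W) := by
      have hv0 := congrArg Subtype.val hab
      exact hv0
    exact Subtype.ext hv
  map_fn n f x := h.2.1 n f _ fun i => (x i).2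
  map_rel n r x := h.2.2 n r _ fun i => (x i).2

/-- The image structure `f[M] ⊆ N` of an embedding `f : M → N`. -/
def Emb.imageStruct {M N : SetStruct L W} (e : Emb M N) : SetStruct L W where
  carrier := Set.range fun x : M.carrier => (e.toFun x : W)
  small := by
    haveI := M.small
    exact small_range _
  fn := N.fn
  rel := N.rel
  fn_mem := by
    intro n f x hx
    choose y hy using hx
    have hy' : ∀ i, (e.toFun (y i) : W) = x i := hy
    refine ⟨⟨M.fn n f fun i => (y i : W), M.fn_mem n f _ fun i => (y i).2⟩, ?_⟩
    show (e.toFun ⟨M.fn n f fun i => (y i : W), M.fn_mem n f _ fun i => (y i).2⟩ : W) =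
      N.fn n f x
    rw [e.map_fn n f y]
    exact congrArg (N.fn n f) (funext hy')

theorem Emb.imageStruct_sub {M N : SetStruct L W} (e : Emb M N) : Sub e.imageStruct N := by
  refine ⟨?_, fun _ _ _ _ => rfl, fun _ _ _ _ => Iff.rfl⟩
  rintro _ ⟨x, rfl⟩
  exact (e.toFun x).2

/-- Corestriction of an embedding onto its image. -/
def Emb.corestrict {M N : SetStruct L W} (e : Emb M N) : Emb M e.imageStruct where
  toFun x := ⟨(e.toFun x : W), ⟨x, rfl⟩⟩
  inj := by
    intro a b h
    have hv : (e.toFun a : W) = (e.toFun b : W) := by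
      have hv0 := congrArg Subtype.val h
      exact hv0
    exact e.inj (Subtype.ext hv)
  map_fn n f x := e.map_fn n f x
  map_rel n r x := e.map_rel n r x

theorem Emb.corestrict_surjective {M N : SetStruct L W} (e : Emb M N) :
    Function.Surjective e.corestrict.toFun := by
  rintro ⟨y, x, rfl⟩
  exact ⟨x, rfl⟩

theorem imageStruct_refl (M : SetStruct L W) : (Emb.refl M).imageStruct = M := by
  refine SetStruct.ext' ?_ (fun _ _ _ => rfl) (fun _ _ _ => Iff.rfl)
  exact Subtype.range_coe

/-! ## Universal classes -/

variable (L W)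

/-- A *universal class*: a class of `τ`-structures closed under isomorphism,
substructures, and unions of directed systems of substructure inclusions. -/
structure UniversalClass : Type (u + 2) where
  K : Set (SetStruct L W)
  iso_closed : ∀ {M N : SetStruct L W} (e : Emb M N),
    Function.Surjective e.toFun → M ∈ K → N ∈ K
  sub_closed : ∀ {M N : SetStruct L W}, Sub M N → N ∈ K → M ∈ K
  union_closed : ∀ (P : IndexPoset.{u}), IsDirected P.J (· ≤ ·) → Nonempty P.J →
    ∀ D : P.J → SetStruct L W, (∀ j, D j ∈ K) →
      (∀ ⦃j j' : P.J⦄, j ≤ j' → Sub (D j) (D j')) →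
      ∀ MU : SetStruct L W, MU.carrier = ⋃ j, (D j).carrier →
        (∀ j, Sub (D j) MU) → MU ∈ K

variable {L W}

/-- The category associated to a universal class: objects are its members,
morphisms are all substructure embeddings. -/
def UnivCat (U : UniversalClass L W) : Type (u + 1) :=
  {M : SetStruct L W // M ∈ U.K}

instance (U : UniversalClass L W) : Category (UnivCat U) where
  Hom M N := Emb M.1 N.1
  id M := Emb.refl M.1
  comp f g := g.comp f
  id_comp _ := Emb.ext' rfl
  comp_id _ := Emb.ext' rfl
  assoc _ _ _ := Emb.ext' rfl

/-! ## Abstract elementary classes -/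

variable (L W)

/-- The Löwenheim–Skolem–Tarski property for the (set-sized) cardinal `κ`. -/
def LSTWitness (K : Set (SetStruct L W))
    (le : SetStruct L W → SetStruct L W → Prop) (κ : Cardinal.{u + 1}) : Prop :=
  κ < Cardinal.univ.{u, u + 1} ∧ Cardinal.lift.{u + 1} L.card ≤ κ ∧ ℵ₀ ≤ κ ∧
    ∀ M ∈ K, ∀ s : Set W, s ⊆ M.carrier →
      ∃ M₀ : SetStruct L W, le M₀ M ∧ s ⊆ M₀.carrier ∧ #M₀.carrier ≤ #s + κ

/-- An abstract elementary class (AEC) in the finitary vocabulary `L`: an abstract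
class (a class of structures closed under isomorphism together with a strong
substructure order `le` refining the substructure relation and respecting
isomorphisms) satisfying coherence, the chain (Tarski–Vaught) axioms, and the
Löwenheim–Skolem–Tarski axiom. -/
structure AEC : Type (u + 2) where
  K : Set (SetStruct L W)
  le : SetStruct L W → SetStruct L W → Prop
  le_mem : ∀ {M N : SetStruct L W}, le M N → M ∈ K ∧ N ∈ K
  le_refl : ∀ M ∈ K, le M M
  le_trans : ∀ {M N P : SetStruct L W}, le M N → le N P → le M P
  le_antisymm : ∀ {M N : SetStruct L W}, le M N → le N M → M = N
  le_sub : ∀ {M N : SetStruct L W}, le M N → Sub M N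
  iso_closed : ∀ {M N : SetStruct L W} (e : Emb M N),
    Function.Surjective e.toFun → M ∈ K → N ∈ K
  le_iso : ∀ {M N N' : SetStruct L W} (e : Emb N N'),
    Function.Surjective e.toFun → ∀ h : le M N,
      le (Emb.imageStruct (Emb.comp e (Sub.emb (le_sub h)))) N'
  coherence : ∀ {M₀ M₁ M₂ : SetStruct L W},
    Sub M₀ M₁ → le M₁ M₂ → le M₀ M₂ → le M₀ M₁
  chain : ∀ (P : IndexPoset.{u}), IsDirected P.J (· ≤ ·) → Nonempty P.J →
    ∀ D : P.J → SetStruct L W, (∀ ⦃j j' : P.J⦄, j ≤ j' → le (D j) (D j')) →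
      ∃ MU : SetStruct L W, MU ∈ K ∧ MU.carrier = ⋃ j, (D j).carrier ∧
        (∀ j, le (D j) MU) ∧ ∀ N : SetStruct L W, (∀ j, le (D j) N) → le MU N
  lst : ∃ κ : Cardinal.{u + 1}, LSTWitness L W K le κ

variable {L W}

/-- The Löwenheim–Skolem–Tarski number of an AEC. -/
def AEC.LS (A : AEC L W) : Cardinal.{u + 1} :=
  sInf {κ | LSTWitness L W A.K A.le κ}

theorem AEC.le_image_comp (A : AEC L W) {M N P : SetStruct L W}
    {f : Emb M N} {g : Emb N P}
    (hf : A.le f.imageStruct N) (hg : A.le g.imageStruct P) :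
    A.le (g.comp f).imageStruct P := by
  have h := A.le_iso g.corestrict g.corestrict_surjective hf
  have key : (Emb.comp g.corestrict (Sub.emb (A.le_sub hf))).imageStruct =
      (g.comp f).imageStruct := by
    refine SetStruct.ext' ?_ (fun _ _ _ => rfl) (fun _ _ _ => Iff.rfl)
    ext w
    constructor
    · rintro ⟨x, hx⟩
      obtain ⟨z, hz⟩ := x.2
      refine ⟨z, ?_⟩
      rw [← hx]
      exact congrArg (fun t : N.carrier => (g.toFun t : W)) (Subtype.ext hz)
    · rintro ⟨z, hz⟩
      refine ⟨⟨(f.toFun z : W), ⟨z, rfl⟩⟩, ?_⟩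
      rw [← hz]
      exact congrArg (fun t : N.carrier => (g.toFun t : W)) (Subtype.ext rfl)
  rw [key] at h
  exact A.le_trans h hg

/-- The category associated to an AEC: objects are its members, morphisms are the
`K`-embeddings, i.e. those embeddings `f : M → N` whose image `f[M]` is a strong
(`≤`) substructure of `N`. -/
def AEC.Cat (A : AEC L W) : Type (u + 1) :=
  {M : SetStruct L W // M ∈ A.K}

instance (A : AEC L W) : Category A.Cat where
  Hom M N := {e : Emb M.1 N.1 // A.le e.imageStruct N.1}
  id M := ⟨Emb.refl M.1, by rw [imageStruct_refl]; exact A.le_refl M.1 M.2⟩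
  comp f g := ⟨g.1.comp f.1, A.le_image_comp f.2 g.2⟩
  id_comp _ := Subtype.ext (Emb.ext' rfl)
  comp_id _ := Subtype.ext (Emb.ext' rfl)
  assoc _ _ _ := Subtype.ext (Emb.ext' rfl)

/-- The closure `cl^N(s)`: the intersection of the universes of all strong
substructures of `N` containing `s`. -/
def AEC.clSet (A : AEC L W) (N : SetStruct L W) (s : Set W) : Set W :=
  ⋂ M ∈ {M : SetStruct L W | A.le M N ∧ s ⊆ M.carrier}, M.carrier

/-- `K` admits intersections: for every `N ∈ K` and `s ⊆ UN`, the set `cl^N(s)` is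
the universe of a strong substructure of `N`. -/
def AEC.AdmitsIntersections (A : AEC L W) : Prop :=
  ∀ N ∈ A.K, ∀ s : Set W, s ⊆ N.carrier →
    ∃ M₀ : SetStruct L W, A.le M₀ N ∧ M₀.carrier = A.clSet N s

theorem AEC.clSet_subset (A : AEC L W) {N : SetStruct L W} (hN : N ∈ A.K)
    {s : Set W} (hs : s ⊆ N.carrier) : A.clSet N s ⊆ N.carrier :=
  Set.biInter_subset_of_mem (⟨A.le_refl N hN, hs⟩ : _ ∈ {M : SetStruct L W | A.le M N ∧ s ⊆ M.carrier})

/-- The canonical structure with universe `cl^N(s)` (the restriction of `N`). -/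
def AEC.clStruct (A : AEC L W) (N : SetStruct L W) (s : Set W)
    (hN : N ∈ A.K) (hs : s ⊆ N.carrier) : SetStruct L W where
  carrier := A.clSet N s
  small := by
    haveI := N.small
    exact small_subset (A.clSet_subset hN hs)
  fn := N.fn
  rel := N.rel
  fn_mem := by
    intro n f x hx
    refine Set.mem_iInter₂.2 fun M hM => ?_
    have hxM : ∀ i, x i ∈ M.carrier := fun i => Set.mem_iInter₂.1 (hx i) M hM
    have hfn := (A.le_sub hM.1).2.1 n f x hxM
    exact hfn ▸ M.fn_mem n f x hxM

/-- `K` is pseudo-universal: it admits intersections and any two `K`-embeddings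
agreeing on a set `s` agree on `cl(s)`. -/
def AEC.PseudoUniversal (A : AEC L W) : Prop :=
  A.AdmitsIntersections ∧
    ∀ M N : SetStruct L W, M ∈ A.K → N ∈ A.K →
      ∀ f g : Emb M N, A.le f.imageStruct N → A.le g.imageStruct N →
        ∀ s : Set W, s ⊆ M.carrier →
          (∀ x : M.carrier, (x : W) ∈ s → f.toFun x = g.toFun x) →
          ∀ x : M.carrier, (x : W) ∈ A.clSet M s → f.toFun x = g.toFun x

/-- The reduct of a structure along a vocabulary morphism `φ : L →ᴸ L'`. -/
def SetStruct.reduct {L L' : FirstOrder.Language.{u, u}} (φ : L →ᴸ L')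
    {W : Type (u + 1)} (M : SetStruct L' W) : SetStruct L W where
  carrier := M.carrier
  small := M.small
  fn n f x := M.fn n (φ.onFunction f) x
  rel n r x := M.rel n (φ.onRelation r) x
  fn_mem n f x hx := M.fn_mem n (φ.onFunction f) x hx

/-- The subset of `N` generated by `s`: the least subset of the universe of `N`
containing `s` and closed under all functions of `N`. -/
def genSet (N : SetStruct L W) (s : Set W) : Set W :=
  ⋂ t ∈ {t : Set W | s ⊆ t ∧ t ⊆ N.carrier ∧
    ∀ (n : ℕ) (f : L.Functions n) (x : Fin n → W), (∀ i, x i ∈ t) → N.fn n f x ∈ t}, t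


/-- The underlying embedding of a morphism in the category of a universal class. -/
def univHomEmb {U : UniversalClass L W} {M N : UnivCat U} (e : M ⟶ N) : Emb M.1 N.1 := e

/-- The underlying embedding of a morphism in the category of an AEC. -/
def aecHomEmb {A : AEC L W} {M N : A.Cat} (e : M ⟶ N) : Emb M.1 N.1 :=
  (e : {f : Emb M.1 N.1 // A.le f.imageStruct N.1}).1

/-! ## The proof -/

section Proof

/-- The vocabulary: a constant, a binary function, unary predicates for the objects
and binary predicates for the morphisms of a small full subcategory. -/
def lang {C : Type (u + 1)} [Category.{u} C] {S : Type u} (obj : S → C) :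
    FirstOrder.Language.{u, u} where
  Functions n := match n with
    | 0 => PUnit
    | 2 => PUnit
    | _ => PEmpty
  Relations n := match n with
    | 1 => S
    | 2 => Σ a b : S, (obj a ⟶ obj b)
    | _ => PEmpty

variable {C : Type (u + 1)} [Category.{u} C] {S : Type u} {obj : S → C}
variable {W : Type (u + 1)}

/-- `x` has sort `a`. -/
def srt (M : SetStruct (lang obj) W) (a : S) (x : M.carrier) : Prop :=
  M.rel 1 (show (lang obj).Relations 1 from a) (fun i => ((fun _ => x) i : M.carrier))

/-- `x` is the restriction of `y` along `g`. -/
def arr (M : SetStruct (lang obj) W) {a b : S} (g : obj a ⟶ obj b) (x y : M.carrier) : Prop :=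
  M.rel 2 (show (lang obj).Relations 2 from ⟨a, b, g⟩) (fun i => ((![x, y] : Fin 2 → M.carrier) i))

/-- The binary operation. -/
def op (M : SetStruct (lang obj) W) (x y : M.carrier) : M.carrier :=
  ⟨M.fn 2 (show (lang obj).Functions 2 from PUnit.unit)
    (fun i => ((![x, y] : Fin 2 → M.carrier) i)), M.fn_mem _ _ _ (fun i => Subtype.coe_prop _)⟩

/-- The constant. -/
def cst (M : SetStruct (lang obj) W) : M.carrier :=
  ⟨M.fn 0 (show (lang obj).Functions 0 from PUnit.unit)
    (fun i => ((Fin.elim0 i : M.carrier))), M.fn_mem _ _ _ (fun i => Subtype.coe_prop _)⟩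

theorem srt_emb {M N : SetStruct (lang obj) W} (e : Emb M N) (a : S) (x : M.carrier) :
    srt N a (e.toFun x) ↔ srt M a x :=
  (e.map_rel 1 _ (fun _ => x)).symm

theorem vec2 {α β : Type*} (f : α → β) (x y : α) :
    (fun i => f ((![x, y] : Fin 2 → α) i)) = ![f x, f y] := by
  funext i; fin_cases i <;> rfl

theorem arr_emb {M N : SetStruct (lang obj) W} (e : Emb M N) {a b : S} (g : obj a ⟶ obj b)
    (x y : M.carrier) : arr N g (e.toFun x) (e.toFun y) ↔ arr M g x y := by
  have h := e.map_rel 2 (show (lang obj).Relations 2 from ⟨a, b, g⟩) ![x, y]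
  unfold arr
  rw [h, ← vec2 e.toFun]

theorem op_emb {M N : SetStruct (lang obj) W} (e : Emb M N) (x y : M.carrier) :
    e.toFun (op M x y) = op N (e.toFun x) (e.toFun y) := by
  apply Subtype.ext
  have h := e.map_fn 2 (show (lang obj).Functions 2 from PUnit.unit) ![x, y]
  refine h.trans ?_
  have h2 := vec2 e.toFun x y
  exact congrArg (fun v : Fin 2 → N.carrier => N.fn 2
    (show (lang obj).Functions 2 from PUnit.unit) (fun i => (v i : W))) h2

/-- The universal axioms defining the class. -/
structure Ax (M : SetStruct (lang obj) W) (x y z : M.carrier) : Prop where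
  ex : ∃ a, srt M a x
  uniq : ∀ a b, srt M a x → srt M b x → a = b
  dom : ∀ (a b : S) (g : obj a ⟶ obj b), arr M g x y → srt M a x
  cod : ∀ (a b : S) (g : obj a ⟶ obj b), arr M g x y → srt M b y
  idd : ∀ a, srt M a x → arr M (𝟙 (obj a)) x x
  comp : ∀ (a b c : S) (g : obj a ⟶ obj b) (h : obj b ⟶ obj c),
    arr M g x y → arr M h y z → arr M (g ≫ h) x z
  thin : ∀ (a b : S) (g g' : obj a ⟶ obj b), arr M g x y → arr M g' x y → g = g'
  sep : ∀ (a b : S) (g : obj a ⟶ obj b), arr M g x z → arr M g y z → x = y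
  left : ∃ (a b : S) (g : obj a ⟶ obj b), arr M g x (op M x y)
  right : ∃ (a b : S) (g : obj a ⟶ obj b), arr M g y (op M x y)

theorem ax_emb {M N : SetStruct (lang obj) W} (e : Emb M N) (x y z : M.carrier) :
    Ax N (e.toFun x) (e.toFun y) (e.toFun z) ↔ Ax M x y z := by
  constructor
  · rintro ⟨h1, h2, h3, h4, h5, h6, h7, h8, h9, h10⟩
    simp only [srt_emb, arr_emb, ← op_emb, e.inj.eq_iff] at h1 h2 h3 h4 h5 h6 h7 h8 h9 h10
    exact ⟨h1, h2, h3, h4, h5, h6, h7, h8, h9, h10⟩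
  · rintro ⟨h1, h2, h3, h4, h5, h6, h7, h8, h9, h10⟩
    constructor <;> simp only [srt_emb, arr_emb, ← op_emb, e.inj.eq_iff] <;> assumption

/-- Membership in the class. -/
def Good (M : SetStruct (lang obj) W) : Prop := ∀ x y z : M.carrier, Ax M x y z

theorem good_of_emb {M N : SetStruct (lang obj) W} (e : Emb M N) (h : Good N) : Good M :=
  fun x y z => (ax_emb e x y z).1 (h _ _ _)

variable (obj W) in
/-- The universal class. -/
def theU : UniversalClass (lang obj) W where
  K := {M | Good M}
  iso_closed := by
    intro M N e he h x y z
    obtain ⟨x, rfl⟩ := he x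
    obtain ⟨y, rfl⟩ := he y
    obtain ⟨z, rfl⟩ := he z
    exact (ax_emb e x y z).2 (h _ _ _)
  sub_closed h hN := good_of_emb h.emb hN
  union_closed := by
    intro P hdir hne D hD hmono MU hU hsub x y z
    have key : ∀ w : MU.carrier, ∃ j, (w : W) ∈ (D j).carrier := by
      intro w
      exact Set.mem_iUnion.1 (hU.subset w.2)
    obtain ⟨i, hi⟩ := key x
    obtain ⟨j, hj⟩ := key y
    obtain ⟨k, hk⟩ := key z
    obtain ⟨l, hil, hjl⟩ := hdir.directed i j
    obtain ⟨m, hlm, hkm⟩ := hdir.directed l k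
    have h := (ax_emb (hsub m).emb ⟨x, (hmono hlm).1 ((hmono hil).1 hi)⟩
      ⟨y, (hmono hlm).1 ((hmono hjl).1 hj)⟩ ⟨z, (hmono hkm).1 hk⟩).2 (hD m _ _ _)
    exact h

section Obj

variable (M : SetStruct (lang obj) W)

/-- The index set of the diagram of `M`. -/
def Idx : Type u := @Shrink.{u} M.carrier M.small

/-- The index set is the carrier. -/
def idxE : M.carrier ≃ Idx M := @equivShrink M.carrier M.small

/-- Families of maps forming a cocone. -/
structure Fam (Y : C) where
  app : ∀ (x : M.carrier) (a : S), srt M a x → (obj a ⟶ Y)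
  nat : ∀ (x y : M.carrier) (a b : S) (hx : srt M a x) (hy : srt M b y) (g : obj a ⟶ obj b),
    arr M g x y → g ≫ app y b hy = app x a hx


theorem exists_universal (hM : Good M)
    (hdc : HasCardDirectedColimits.{u} (ℵ₀ : Cardinal.{u}) C) :
    ∃ (X : C) (I : Fam M X), (∀ (Y : C) (J : Fam M Y), ∃ f : X ⟶ Y,
      ∀ x a h, I.app x a h ≫ f = J.app x a h) ∧
      (∀ (Y : C) (f g : X ⟶ Y), (∀ x a h, I.app x a h ≫ f = I.app x a h ≫ g) → f = g) := by
  classical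
  choose sort hsort using fun x : M.carrier => (hM x x x).ex
  have suniq : ∀ {x a}, srt M a x → a = sort x := fun {x a} h =>
    (hM x x x).uniq _ _ h (hsort x)
  let E := idxE M
  letI pre : Preorder (Idx M) :=
    { le := fun x y => ∃ g : obj (sort (E.symm x)) ⟶ obj (sort (E.symm y)),
        arr M g (E.symm x) (E.symm y)
      le_refl := fun x => ⟨𝟙 _, (hM _ (E.symm x) (E.symm x)).idd _ (hsort _)⟩
      le_trans := fun x y z ⟨g, hg⟩ ⟨h, hh⟩ => ⟨g ≫ h, (hM _ _ _).comp _ _ _ g h hg hh⟩ }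
  have mkle : ∀ (x y : M.carrier) {a b : S} (g : obj a ⟶ obj b), arr M g x y → E x ≤ E y := by
    intro x y a b g hg
    have ha := suniq ((hM x y y).dom _ _ _ hg)
    have hb := suniq ((hM x y y).cod _ _ _ hg)
    subst ha hb
    show ∃ g : obj (sort (E.symm (E x))) ⟶ obj (sort (E.symm (E y))),
        arr M g (E.symm (E x)) (E.symm (E y))
    rw [E.symm_apply_apply, E.symm_apply_apply]
    exact ⟨g, hg⟩
  have hdir2 : ∀ i j : Idx M, ∃ k, i ≤ k ∧ j ≤ k := by
    intro i j
    obtain ⟨x, rfl⟩ := E.surjective i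
    obtain ⟨y, rfl⟩ := E.surjective j
    obtain ⟨_, _, g, hg⟩ := (hM x y y).left
    obtain ⟨_, _, h, hh⟩ := (hM x y y).right
    exact ⟨E (op M x y), mkle _ _ _ hg, mkle _ _ _ hh⟩
  have hdir : CardDirected (ℵ₀ : Cardinal.{u}) (Idx M) := by
    intro T hT
    have hfin : T.Finite := Cardinal.lt_aleph0_iff_set_finite.1 hT
    refine Set.Finite.induction_on (motive := fun T _ => ∃ j, ∀ s ∈ T, s ≤ j) T hfin
      ⟨E (cst M), by simp⟩ ?_
    rintro a T _ _ ⟨j, hj⟩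
    obtain ⟨k, hak, hjk⟩ := hdir2 a j
    refine ⟨k, ?_⟩
    rintro s (rfl | hs)
    · exact hak
    · exact (hj s hs).trans hjk
  haveI := hdc (Idx M) hdir
  have mspec : ∀ {x y : Idx M} (h : x ≤ y), ∃ g : obj (sort (E.symm x)) ⟶ obj (sort (E.symm y)),
        arr M g (E.symm x) (E.symm y) := fun h => h
  let D : Idx M ⥤ C :=
    { obj := fun x => obj (sort (E.symm x))
      map := fun f => (mspec (leOfHom f)).choose
      map_id := fun x => (hM _ _ (E.symm x)).thin _ _ _ _ (mspec (leOfHom (𝟙 x))).choose_spec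
        ((hM _ (E.symm x) (E.symm x)).idd _ (hsort _))
      map_comp := fun {x y z} f g => (hM _ _ (E.symm x)).thin _ _ _ _
        (mspec (leOfHom (f ≫ g))).choose_spec
        ((hM _ _ _).comp _ _ _ _ _ (mspec (leOfHom f)).choose_spec
          (mspec (leOfHom g)).choose_spec) }
  have Dmap : ∀ {x y : Idx M} (f : x ⟶ y) (g : obj (sort (E.symm x)) ⟶ obj (sort (E.symm y))),
      arr M g (E.symm x) (E.symm y) → D.map f = g := fun {x y} f g hg =>
    (hM _ _ (E.symm x)).thin _ _ _ _ (mspec (leOfHom f)).choose_spec hg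
  have Darr : ∀ {x y : Idx M} (f : x ⟶ y), arr M (D.map f) (E.symm x) (E.symm y) :=
    fun {x y} f => (mspec (leOfHom f)).choose_spec
  have seq : ∀ {x a}, srt M a x → a = sort (E.symm (E x)) := fun {x a} h => by
    rw [E.symm_apply_apply]; exact suniq h
  have key : ∀ {x a} (i : Idx M) (hx : srt M a x) (hi : x = E.symm i),
      a = sort (E.symm i) := fun {x a} i h hi => by
    subst hi; exact suniq h
  let I : Fam M (colimit D) :=
    { app := fun x a h => eqToHom (congrArg obj (seq h)) ≫ colimit.ι D (E x)
      nat := by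
        intro x y a b hx hy g hg
        have hf : E x ⟶ E y := homOfLE (mkle _ _ _ hg)
        rw [← colimit.w D hf]
        have gen : ∀ (i j : Idx M) (hi : x = E.symm i) (hj : y = E.symm j) (f : i ⟶ j),
            g ≫ eqToHom (congrArg obj (key j hy hj)) ≫ colimit.ι D j =
              eqToHom (congrArg obj (key i hx hi)) ≫ D.map f ≫ colimit.ι D j := by
          intro i j hi hj f
          subst hi hj
          have ha := suniq hx
          have hb := suniq hy
          subst ha hb
          rw [Dmap f g hg]
          simp
        exact gen (E x) (E y) (by simp) (by simp) hf }
  have Iapp : ∀ i : Idx M, I.app (E.symm i) _ (hsort _) = colimit.ι D i := by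
    intro i
    have gen : ∀ (k : Idx M) (hk : k = i),
        eqToHom (congrArg obj (by rw [hk])) ≫ colimit.ι D k = colimit.ι D i := by
      intro k hk; subst hk; simp
    exact gen (E (E.symm i)) (by simp)
  have uni : ∀ (Y : C) (f g : colimit D ⟶ Y),
      (∀ x a h, I.app x a h ≫ f = I.app x a h ≫ g) → f = g := by
    intro Y f g h
    refine colimit.hom_ext fun i => ?_
    rw [← Iapp]
    exact h _ _ _
  refine ⟨colimit D, I, ?_, uni⟩
  intro Y J
  refine ⟨colimit.desc D ⟨Y, { app := fun i => J.app (E.symm i) _ (hsort _)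
                               naturality := ?_ }⟩, ?_⟩
  · intro i j f
    have := J.nat _ _ _ _ (hsort (E.symm i)) (hsort (E.symm j)) _ (Darr f)
    simpa using this
  · intro x a h
    obtain ⟨i, rfl⟩ := E.symm.surjective x
    have ha := suniq h
    subst ha
    rw [Iapp]
    simp

end Obj

section Functor

variable (hdc : HasCardDirectedColimits.{u} (ℵ₀ : Cardinal.{u}) C)

/-- The object assigned to a structure. -/
def fObj (M : UnivCat (theU obj W)) : C :=
  (exists_universal M.1 M.2 hdc).choose

/-- The universal family. -/
def fFam (M : UnivCat (theU obj W)) : Fam M.1 (fObj hdc M) :=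
  (exists_universal M.1 M.2 hdc).choose_spec.choose

/-- The universal property. -/
def fDesc (M : UnivCat (theU obj W)) {Y : C} (J : Fam M.1 Y) : fObj hdc M ⟶ Y :=
  ((exists_universal M.1 M.2 hdc).choose_spec.choose_spec.1 Y J).choose

theorem fDesc_fac (M : UnivCat (theU obj W)) {Y : C} (J : Fam M.1 Y) (x a h) :
    (fFam hdc M).app x a h ≫ fDesc hdc M J = J.app x a h :=
  ((exists_universal M.1 M.2 hdc).choose_spec.choose_spec.1 Y J).choose_spec x a h

theorem fExt (M : UnivCat (theU obj W)) {Y : C} (f g : fObj hdc M ⟶ Y)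
    (h : ∀ x a h, (fFam hdc M).app x a h ≫ f = (fFam hdc M).app x a h ≫ g) : f = g :=
  (exists_universal M.1 M.2 hdc).choose_spec.choose_spec.2 Y f g h

/-- Pulling back a family along an embedding. -/
def Fam.pull {M N : SetStruct (lang obj) W} (e : Emb M N) {Y : C} (J : Fam N Y) : Fam M Y where
  app x a h := J.app (e.toFun x) a ((srt_emb e a x).2 h)
  nat x y a b _ _ g hg := J.nat _ _ _ _ _ _ g ((arr_emb e g x y).2 hg)

variable (obj W) in
/-- The functor. -/
def theF : UnivCat (theU obj W) ⥤ C where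
  obj M := fObj hdc M
  map {M N} e := fDesc hdc M ((fFam hdc N).pull (univHomEmb e))
  map_id M := by
    apply fExt
    intro x a h
    rw [fDesc_fac, Category.comp_id]
    rfl
  map_comp {M N P} e f := by
    apply fExt
    intro x a h
    rw [fDesc_fac, ← Category.assoc, fDesc_fac]
    exact (fDesc_fac hdc N ((fFam hdc P).pull (univHomEmb f)) _ _ _).symm

theorem theF_fac {M N : UnivCat (theU obj W)} (e : M ⟶ N) (x a h) :
    (fFam hdc M).app x a h ≫ (theF obj W hdc).map e =
      (fFam hdc N).app ((univHomEmb e).toFun x) a ((srt_emb _ _ _).2 h) :=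
  fDesc_fac hdc M _ x a h

theorem fFam_inj (hmono : ∀ ⦃X Y : C⦄ (f : X ⟶ Y), Mono f) (M : UnivCat (theU obj W))
    (x y a hx hy) (h : (fFam hdc M).app x a hx = (fFam hdc M).app y a hy) : x = y := by
  have hM : Good M.1 := M.2
  obtain ⟨a1, b1, g1, h1⟩ := (hM x y y).left
  obtain ⟨a2, b2, g2, h2⟩ := (hM x y y).right
  obtain rfl := (hM x x x).uniq _ _ hx ((hM _ _ x).dom _ _ _ h1)
  obtain rfl := (hM y y y).uniq _ _ hy ((hM _ _ x).dom _ _ _ h2)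
  have hz1 := (hM _ _ x).cod _ _ _ h1
  obtain rfl := (hM _ x x).uniq _ _ hz1 ((hM _ _ x).cod _ _ _ h2)
  rw [← (fFam hdc M).nat _ _ _ _ hx hz1 g1 h1, ← (fFam hdc M).nat _ _ _ _ hy hz1 g2 h2] at h
  haveI := hmono ((fFam hdc M).app _ _ hz1)
  rw [cancel_mono] at h
  subst h
  exact (hM _ _ _).sep _ _ _ h1 h2

theorem theF_faithful (hmono : ∀ ⦃X Y : C⦄ (f : X ⟶ Y), Mono f) :
    (theF obj W hdc).Faithful where
  map_injective {M N} e f h := by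
    refine Emb.ext' (e₁ := univHomEmb e) (e₂ := univHomEmb f) (funext fun x => ?_)
    have hM : Good M.1 := M.2
    obtain ⟨a, ha⟩ := (hM x x x).ex
    refine fFam_inj hdc hmono N _ _ a ((srt_emb _ _ _).2 ha) ((srt_emb _ _ _).2 ha) ?_
    rw [← theF_fac hdc e x a ha, ← theF_fac hdc f x a ha, h]

end Functor

section Colim

variable (hdc : HasCardDirectedColimits.{u} (ℵ₀ : Cardinal.{u}) C)

/-- The substructure on a closed subset. -/
def restr (M : SetStruct (lang obj) W) (s : Set W) (hs : s ⊆ M.carrier)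
    (hc : ∀ (n : ℕ) (f : (lang obj).Functions n) (x : Fin n → W),
      (∀ i, x i ∈ s) → M.fn n f x ∈ s) : SetStruct (lang obj) W where
  carrier := s
  small := by
    have := M.small
    exact small_subset hs
  fn := M.fn
  rel := M.rel
  fn_mem := hc

theorem restr_sub (M : SetStruct (lang obj) W) (s hs hc) : Sub (restr M s hs hc) M :=
  ⟨hs, fun _ _ _ _ => rfl, fun _ _ _ _ => Iff.rfl⟩

/-- Factor an embedding through a substructure. -/
def Emb.lift {M N P : SetStruct (lang obj) W} (e : Emb M N) (h : Sub P N)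
    (hr : ∀ x, (e.toFun x : W) ∈ P.carrier) : Emb M P where
  toFun x := ⟨e.toFun x, hr x⟩
  inj x y hxy := e.inj (Subtype.ext (congrArg (fun t : P.carrier => (t : W)) hxy))
  map_fn n f x := (e.map_fn n f x).trans (h.2.1 n f _ (fun i => hr (x i))).symm
  map_rel n r x := (e.map_rel n r x).trans (h.2.2 n r _ (fun i => hr (x i))).symm

theorem jointly_surj (J : Type u) [Preorder J] (hd : IsDirected J (· ≤ ·)) (hn : Nonempty J)
    (K : J ⥤ UnivCat (theU obj W)) (c : Cocone K) (hc : IsColimit c) (w : c.pt.1.carrier) :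
    ∃ (j : J) (x : (K.obj j).1.carrier), (univHomEmb (c.ι.app j)).toFun x = w := by
  let s : Set W := {w | ∃ (j : J) (x : (K.obj j).1.carrier),
    ((univHomEmb (c.ι.app j)).toFun x : W) = w}
  have hs : s ⊆ c.pt.1.carrier := by
    rintro _ ⟨j, x, rfl⟩
    exact Subtype.coe_prop _
  have push : ∀ {j k : J} (h : j ≤ k) (x : (K.obj j).1.carrier),
      (univHomEmb (c.ι.app k)).toFun ((univHomEmb (K.map (homOfLE h))).toFun x) =
        (univHomEmb (c.ι.app j)).toFun x := by
    intro j k h x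
    have := c.w (homOfLE h)
    rw [← this]
    rfl
  have hcl : ∀ (n : ℕ) (f : (lang obj).Functions n) (x : Fin n → W),
      (∀ i, x i ∈ s) → c.pt.1.fn n f x ∈ s := by
    intro n f x hx
    choose j y hy using hx
    obtain ⟨k, hk⟩ := (Set.finite_range j).bddAbove
    have hk' : ∀ i, j i ≤ k := fun i => hk ⟨i, rfl⟩
    let z : Fin n → (K.obj k).1.carrier :=
      fun i => (univHomEmb (K.map (homOfLE (hk' i)))).toFun (y i)
    have hz : ∀ i, ((univHomEmb (c.ι.app k)).toFun (z i) : W) = x i := by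
      intro i
      rw [← hy i, ← push (hk' i)]
    refine ⟨k, _, ((univHomEmb (c.ι.app k)).map_fn n f z).trans ?_⟩
    exact congrArg (c.pt.1.fn n f) (funext hz)
  let P : SetStruct (lang obj) W := restr c.pt.1 s hs hcl
  have hP : Sub P c.pt.1 := restr_sub _ _ _ _
  let P' : UnivCat (theU obj W) := ⟨P, (theU obj W).sub_closed hP c.pt.2⟩
  let m : P' ⟶ c.pt := (hP.emb : Emb P c.pt.1)
  let c' : Cocone K :=
    { pt := P'
      ι := { app := fun j => (Emb.lift (univHomEmb (c.ι.app j)) hP (fun x => ⟨j, x, rfl⟩) :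
                Emb (K.obj j).1 P)
             naturality := by
              intro i j f
              refine Emb.ext' (funext fun x => Subtype.ext ?_)
              exact congrArg (fun t : c.pt.1.carrier => (t : W)) (push (leOfHom f) x) } }
  have hm : hc.desc c' ≫ m = 𝟙 _ := by
    apply hc.hom_ext
    intro j
    rw [← Category.assoc, hc.fac, Category.comp_id]
    rfl
  have hw : (univHomEmb (hc.desc c' ≫ m)).toFun w = w := by rw [hm]; rfl
  have hv : ((univHomEmb (hc.desc c')).toFun w : W) = w := congrArg Subtype.val hw
  obtain ⟨j, x, hx⟩ := ((univHomEmb (hc.desc c')).toFun w).2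
  exact ⟨j, x, Subtype.ext (hx.trans hv)⟩

theorem theF_pres : PreservesDirectedColimits.{u} (theF obj W hdc) := by
  intro J _ hd hn
  refine ⟨fun {K} => ⟨fun {c} hc => ?_⟩⟩
  choose j y hy using jointly_surj J hd hn K c hc
  have hs : ∀ {x : c.pt.1.carrier} {a}, srt c.pt.1 a x → srt (K.obj (j x)).1 a (y x) := by
    intro x a h
    rw [← srt_emb (univHomEmb (c.ι.app (j x))), hy]
    exact h
  have push : ∀ {j k : J} (h : j ≤ k) (x : (K.obj j).1.carrier),
      (univHomEmb (c.ι.app k)).toFun ((univHomEmb (K.map (homOfLE h))).toFun x) =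
        (univHomEmb (c.ι.app j)).toFun x := by
    intro j k h x
    have := c.w (homOfLE h)
    rw [← this]
    rfl
  -- naturality across stages
  have nat : ∀ (s : Cocone (K ⋙ theF obj W hdc)) (i k : J) (x : (K.obj i).1.carrier)
      (z : (K.obj k).1.carrier) (a b : S) (hx : srt _ a x) (hz : srt _ b z) (g : obj a ⟶ obj b),
      arr c.pt.1 g ((univHomEmb (c.ι.app i)).toFun x) ((univHomEmb (c.ι.app k)).toFun z) →
      g ≫ (fFam hdc (K.obj k)).app z b hz ≫ s.ι.app k =
        (fFam hdc (K.obj i)).app x a hx ≫ s.ι.app i := by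
    intro s i k x z a b hx hz g hg
    obtain ⟨l, hil, hkl⟩ := hd.directed i k
    have w1 := s.w (homOfLE hil)
    have w2 := s.w (homOfLE hkl)
    rw [← push hil, ← push hkl, arr_emb] at hg
    have e1 := theF_fac hdc (K.map (homOfLE hil)) x a hx
    have e2 := theF_fac hdc (K.map (homOfLE hkl)) z b hz
    have e3 := (fFam hdc (K.obj l)).nat _ _ _ _ ((srt_emb _ _ _).2 hx) ((srt_emb _ _ _).2 hz) g hg
    rw [← w1, ← w2]
    rw [← e1, ← e2] at e3
    have e4 := congrArg (fun t => t ≫ s.ι.app l) e3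
    refine Eq.trans ?_ (e4.trans (Category.assoc _ _ _))
    exact ((Category.assoc _ _ _).trans (congrArg (fun t => g ≫ t) (Category.assoc _ _ _))).symm
  refine ⟨{ desc := fun s => fDesc hdc c.pt
              { app := fun x a h => (fFam hdc _).app (y x) a (hs h) ≫ s.ι.app (j x)
                nat := ?_ }
            fac := ?_
            uniq := ?_ }⟩
  · intro x z a b hx hz g hg
    apply nat
    rw [hy, hy]
    exact hg
  · intro s i
    refine fExt hdc (K.obj i) _ _ ?_
    intro x a h
    have hgood : Good c.pt.1 := c.pt.2
    have e1 := theF_fac hdc (c.ι.app i) x a h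
    have h' := (srt_emb (univHomEmb (c.ι.app i)) a x).2 h
    refine (Category.assoc _ _ _).symm.trans ?_
    refine (congrArg (fun t => t ≫ _) e1).trans ?_
    refine (fDesc_fac hdc c.pt _ _ _ _).trans ?_
    have := nat s i _ x (y ((univHomEmb (c.ι.app i)).toFun x)) a a h (hs h') (𝟙 _) (by
      rw [hy]
      exact (hgood _ (cst _) (cst _)).idd _ h')
    rw [Category.id_comp] at this
    exact this
  · intro s m hm
    apply fExt
    intro x a h
    refine Eq.trans ?_ (fDesc_fac hdc c.pt _ _ _ _).symm
    have e1 := theF_fac hdc (c.ι.app (j x)) (y x) a (hs h)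
    have gen : ∀ (x' : c.pt.1.carrier) (h1 : srt _ a x') (hx : x' = x),
      (fFam hdc c.pt).app x' a h1 = (fFam hdc c.pt).app x a h := by
      intro x' _ hx; subst hx; rfl
    have e2 := e1.trans (gen _ _ (hy x))
    show (fFam hdc c.pt).app x a h ≫ m =
      (fFam hdc (K.obj (j x))).app (y x) a (hs h) ≫ s.ι.app (j x)
    have e3 := congrArg (fun t => (fFam hdc (K.obj (j x))).app (y x) a (hs h) ≫ t) (hm (j x))
    refine Eq.trans ?_ e3
    refine Eq.trans ?_ (Category.assoc _ _ _)
    exact congrArg (fun t => t ≫ m) e2.symm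

end Colim

section Ess

variable (obj) in
/-- Elements of `X`. -/
abbrev Elt (X : C) : Type u := Σ a : S, (obj a ⟶ X)

/-- The relations on elements. -/
def eltRel (X : C) : ∀ n : ℕ, (lang obj).Relations n → (Fin n → Elt obj X) → Prop
  | 0, r, _ => PEmpty.elim r
  | 1, a, x => ∃ f, x 0 = (⟨a, f⟩ : Σ a : S, (obj a ⟶ X))
  | 2, g, x => ∃ f, x 0 = (⟨g.1, g.2.2 ≫ f⟩ : Σ a : S, (obj a ⟶ X)) ∧
      x 1 = (⟨g.2.1, f⟩ : Σ a : S, (obj a ⟶ X))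
  | (_ + 3), r, _ => PEmpty.elim r

/-- The functions on elements. -/
def eltFn (X : C) (c : Elt obj X) (o : Elt obj X → Elt obj X → Elt obj X) :
    ∀ n : ℕ, (lang obj).Functions n → (Fin n → Elt obj X) → Elt obj X
  | 0, _, _ => c
  | 1, r, _ => PEmpty.elim r
  | 2, _, x => o (x 0) (x 1)
  | (_ + 3), r, _ => PEmpty.elim r

/-- The injection into the ambient class. -/
def inW (X : C) (t : Elt obj X) : Σ T : Type u, T := ⟨Elt obj X, t⟩

theorem inW_inj (X : C) : Function.Injective (inW (obj := obj) X) := by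
  intro s t h
  simpa [inW] using h

/-- The structure of elements of `X`. -/
def eltStruct (X : C) (c : Elt obj X) (o : Elt obj X → Elt obj X → Elt obj X) :
    SetStruct (lang obj) (Σ T : Type u, T) where
  carrier := Set.range (inW X)
  small := small_range _
  fn n f w := inW X (eltFn X c o n f (fun i => @Function.invFun _ _ ⟨c⟩ (inW X) (w i)))
  rel n r w := eltRel X n r (fun i => @Function.invFun _ _ ⟨c⟩ (inW X) (w i))
  fn_mem _ _ _ _ := ⟨_, rfl⟩

/-- Elements of `X` as points of the structure. -/
def pt {X : C} (c : Elt obj X) (o : Elt obj X → Elt obj X → Elt obj X) (t : Elt obj X) :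
    (eltStruct X c o).carrier := ⟨inW X t, t, rfl⟩

theorem pt_surj {X : C} (c : Elt obj X) (o : Elt obj X → Elt obj X → Elt obj X)
    (w : (eltStruct X c o).carrier) : ∃ t, w = pt c o t := by
  obtain ⟨w, t, rfl⟩ := w
  exact ⟨t, rfl⟩

theorem inv_pt {X : C} (c : Elt obj X) (t : Elt obj X) :
    @Function.invFun _ _ ⟨c⟩ (inW X) (inW X t) = t :=
  @Function.leftInverse_invFun _ _ ⟨c⟩ _ (inW_inj X) t

theorem srt_pt {X : C} (c : Elt obj X) (o : Elt obj X → Elt obj X → Elt obj X) (a t) :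
    srt (eltStruct X c o) a (pt c o t) ↔ ∃ f, t = (⟨a, f⟩ : Σ a : S, (obj a ⟶ X)) := by
  show (∃ f, @Function.invFun _ _ ⟨c⟩ (inW X) (inW X t) = (⟨a, f⟩ : Σ a : S, (obj a ⟶ X))) ↔ _
  rw [inv_pt c]

theorem arr_pt {X : C} (c : Elt obj X) (o : Elt obj X → Elt obj X → Elt obj X)
    {a b : S} (g : obj a ⟶ obj b) (s t) :
    arr (eltStruct X c o) g (pt c o s) (pt c o t) ↔
      ∃ f, s = (⟨a, g ≫ f⟩ : Σ a : S, (obj a ⟶ X)) ∧ t = (⟨b, f⟩ : Σ a : S, (obj a ⟶ X)) := by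
  show (∃ f, @Function.invFun _ _ ⟨c⟩ (inW X) (inW X s) = (⟨a, g ≫ f⟩ : Σ a : S, (obj a ⟶ X)) ∧
    @Function.invFun _ _ ⟨c⟩ (inW X) (inW X t) = (⟨b, f⟩ : Σ a : S, (obj a ⟶ X))) ↔ _
  rw [inv_pt c, inv_pt c]

theorem op_pt {X : C} (c : Elt obj X) (o : Elt obj X → Elt obj X → Elt obj X) (s t) :
    op (eltStruct X c o) (pt c o s) (pt c o t) = pt c o (o s t) := by
  apply Subtype.ext
  show inW X (o (@Function.invFun _ _ ⟨c⟩ (inW X) (inW X s))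
    (@Function.invFun _ _ ⟨c⟩ (inW X) (inW X t))) = inW X (o s t)
  rw [inv_pt c, inv_pt c]

theorem elt_good (hmono : ∀ ⦃X Y : C⦄ (f : X ⟶ Y), Mono f) {X : C} (c : Elt obj X)
    (o : Elt obj X → Elt obj X → Elt obj X)
    (ho1 : ∀ s t, ∃ g : obj s.1 ⟶ obj (o s t).1, s.2 = g ≫ (o s t).2)
    (ho2 : ∀ s t, ∃ g : obj t.1 ⟶ obj (o s t).1, t.2 = g ≫ (o s t).2) :
    Good (eltStruct X c o) := by
  intro x y z
  obtain ⟨x, rfl⟩ := pt_surj c o x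
  obtain ⟨y, rfl⟩ := pt_surj c o y
  obtain ⟨z, rfl⟩ := pt_surj c o z
  constructor
  · exact ⟨x.1, (srt_pt c o _ _).2 ⟨x.2, rfl⟩⟩
  · simp only [srt_pt]
    rintro a b ⟨f, rfl⟩ ⟨g, hg⟩
    exact congrArg Sigma.fst hg
  · simp only [srt_pt, arr_pt]
    rintro a b g ⟨f, h, -⟩
    exact ⟨_, h⟩
  · simp only [srt_pt, arr_pt]
    rintro a b g ⟨f, -, h⟩
    exact ⟨_, h⟩
  · simp only [srt_pt, arr_pt]
    rintro a ⟨f, h⟩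
    exact ⟨f, by simpa using h, h⟩
  · simp only [arr_pt]
    rintro a b d g h ⟨f, rfl, hy⟩ ⟨f', rfl, rfl⟩
    simp only [Sigma.mk.injEq, heq_eq_eq, true_and] at hy
    exact ⟨f', by simp [← hy], rfl⟩
  · simp only [arr_pt]
    rintro a b g g' ⟨f, rfl, rfl⟩ ⟨f', h1, h2⟩
    simp only [Sigma.mk.injEq, heq_eq_eq, true_and] at h1 h2
    subst h2
    have := hmono f
    exact (cancel_mono f).1 h1
  · simp only [arr_pt]
    rintro a b g ⟨f, rfl, rfl⟩ ⟨f', rfl, h2⟩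
    simp only [Sigma.mk.injEq, heq_eq_eq, true_and] at h2
    subst h2
    rfl
  · obtain ⟨g, hg⟩ := ho1 x y
    refine ⟨_, _, g, ?_⟩
    rw [op_pt, arr_pt]
    exact ⟨(o x y).2, by rw [← hg], rfl⟩
  · obtain ⟨g, hg⟩ := ho2 x y
    refine ⟨_, _, g, ?_⟩
    rw [op_pt, arr_pt]
    exact ⟨(o x y).2, by rw [← hg], rfl⟩

theorem ess (hdc : HasCardDirectedColimits.{u} (ℵ₀ : Cardinal.{u}) C)
    (hmono : ∀ ⦃X Y : C⦄ (f : X ⟶ Y), Mono f)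
    {J : Type u} [Preorder J] (hd : IsDirected J (· ≤ ·)) (hn : Nonempty J) (D : J ⥤ C)
    (k : Cocone D) (hk : IsColimit k)
    (hD : ∀ j, ∃ a, Nonempty (obj a ≅ D.obj j))
    (hpres : ∀ (a : S) (f : obj a ⟶ k.pt), ∃ (j : J) (g : obj a ⟶ D.obj j), g ≫ k.ι.app j = f) :
    ∃ M : UnivCat (theU obj (Σ T : Type u, T)),
      Nonempty ((theF obj (Σ T : Type u, T) hdc).obj M ≅ k.pt) := by
  choose a i' using hD
  let i := fun j => (i' j).some
  let el : J → Elt obj k.pt := fun j => ⟨a j, (i j).hom ≫ k.ι.app j⟩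
  have ub : ∀ s t : Elt obj k.pt, ∃ m : Elt obj k.pt,
      (∃ g : obj s.1 ⟶ obj m.1, s.2 = g ≫ m.2) ∧ (∃ g : obj t.1 ⟶ obj m.1, t.2 = g ≫ m.2) := by
    rintro ⟨s, f⟩ ⟨t, f'⟩
    obtain ⟨j, g, rfl⟩ := hpres s f
    obtain ⟨j', g', rfl⟩ := hpres t f'
    obtain ⟨l, h, h'⟩ := hd.directed j j'
    exact ⟨el l, ⟨g ≫ D.map (homOfLE h) ≫ (i l).inv, by simp [el]⟩,
      ⟨g' ≫ D.map (homOfLE h') ≫ (i l).inv, by simp [el]⟩⟩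
  choose o ho1 ho2 using ub
  let c : Elt obj k.pt := el hn.some
  let M : UnivCat (theU obj (Σ T : Type u, T)) :=
    ⟨eltStruct k.pt c o, elt_good hmono c o ho1 ho2⟩
  refine ⟨M, ?_⟩
  have hsx : ∀ (x : M.1.carrier) (b : S), srt M.1 b x →
      ∃ f : obj b ⟶ k.pt, x = pt c o (⟨b, f⟩ : Σ a : S, (obj a ⟶ k.pt)) := by
    intro x b h
    obtain ⟨t, rfl⟩ := pt_surj c o x
    obtain ⟨f, rfl⟩ := (srt_pt c o _ _).1 h
    exact ⟨f, rfl⟩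
  choose φ hφ using hsx
  have pinj : ∀ {b : S} {f f' : obj b ⟶ k.pt},
      pt c o (⟨b, f⟩ : Σ a : S, (obj a ⟶ k.pt)) = pt c o ⟨b, f'⟩ → f = f' := by
    intro b f f' h
    have h1 := inW_inj k.pt (congrArg Subtype.val h)
    simpa using (Sigma.mk.inj h1).2
  have φpt : ∀ (b : S) (f : obj b ⟶ k.pt) (h), φ (pt c o ⟨b, f⟩) b h = f := by
    intro b f h
    exact (pinj (hφ _ b h)).symm
  let Φ : Fam M.1 k.pt :=
    { app := φ
      nat := by
        intro x y b d hx hy g hg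
        have h1 := hφ x b hx
        have h2 := hφ y d hy
        rw [h1, h2] at hg
        obtain ⟨f, h3, h4⟩ := (arr_pt c o g _ _).1 hg
        simp only [Sigma.mk.injEq, heq_eq_eq, true_and] at h3 h4
        rw [h3, h4] }
  have hel : ∀ j, srt M.1 (a j) (pt c o (el j)) := fun j => (srt_pt c o _ _).2 ⟨_, rfl⟩
  have harr : ∀ (b : S) (j : J) (g : obj b ⟶ D.obj j),
      arr M.1 (g ≫ (i j).inv) (pt c o ⟨b, g ≫ k.ι.app j⟩) (pt c o (el j)) := by
    intro b j g
    refine (arr_pt c o _ _ _).2 ⟨(i j).hom ≫ k.ι.app j, ?_, rfl⟩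
    simp
  let I := fFam hdc M
  let ψ : Cocone D :=
    { pt := fObj hdc M
      ι := { app := fun j => (i j).inv ≫ I.app (pt c o (el j)) (a j) (hel j)
             naturality := by
              intro j l f
              have h1 := harr (a j) l ((i j).hom ≫ D.map f)
              have h2 : (pt c o ⟨a j, ((i j).hom ≫ D.map f) ≫ k.ι.app l⟩) = pt c o (el j) := by
                simp [el]
              rw [h2] at h1
              have h3 := I.nat _ _ _ _ (hel j) (hel l) _ h1
              rw [← h3]
              simp } }
  obtain ⟨p, hp⟩ : ∃ p : fObj hdc M ⟶ k.pt, ∀ x b h, I.app x b h ≫ p = φ x b h :=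
    ⟨fDesc hdc M Φ, fDesc_fac hdc M Φ⟩
  obtain ⟨q, hq⟩ : ∃ q : k.pt ⟶ fObj hdc M, ∀ j, k.ι.app j ≫ q =
      (i j).inv ≫ I.app (pt c o (el j)) (a j) (hel j) := ⟨hk.desc ψ, hk.fac ψ⟩
  have hpq : p ≫ q = 𝟙 _ := by
    apply fExt
    intro x b h
    obtain ⟨f, hf⟩ : ∃ f, x = pt c o ⟨b, f⟩ := ⟨_, hφ x b h⟩
    subst hf
    obtain ⟨j, g, rfl⟩ := hpres b f
    have h1 := I.nat _ _ _ _ h (hel j) _ (harr b j g)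
    have h2 := hp _ b h
    rw [φpt] at h2
    rw [← Category.assoc, Category.comp_id]
    refine (congrArg (fun t => t ≫ q) h2).trans ?_
    refine Eq.trans ?_ h1
    simp [hq]
  have hqp : q ≫ p = 𝟙 _ := by
    apply hk.hom_ext
    intro j
    rw [← Category.assoc, hq, Category.assoc, hp, φpt]
    simp
  exact ⟨{ hom := p, inv := q, hom_inv_id := hpq, inv_hom_id := hqp }⟩

end Ess

end Proof

/-- Every accessible category with all directed colimits whose
morphisms are monomorphisms is the essential image, by a faithful functor preserving
directed colimits, of a universal class. -/
theorem statement_2 (C : Type (u + 1)) [Category.{u} C]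
    (hacc : ∃ κ : Cardinal.{u}, κ.IsRegular ∧ IsCardAccessible.{u} κ C)
    (hdc : HasCardDirectedColimits.{u} (ℵ₀ : Cardinal.{u}) C)
    (hmono : ∀ ⦃X Y : C⦄ (f : X ⟶ Y), Mono f) :
    ∃ (L : FirstOrder.Language.{u, u}) (W : Type (u + 1)) (U : UniversalClass L W)
      (F : UnivCat U ⥤ C),
      F.Faithful ∧ F.EssSurj ∧ PreservesDirectedColimits.{u} F := by
  obtain ⟨κ, hκ, _, S, hS, hSp, hgen⟩ := hacc
  have hS' := hS
  let obj : Shrink.{u} S → C := fun a => ((equivShrink S).symm a).1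
  refine ⟨lang obj, Σ T : Type u, T, theU obj _, theF obj _ hdc,
    theF_faithful hdc hmono, ⟨fun X => ?_⟩, theF_pres hdc⟩
  obtain ⟨P, D, k, hdir, hD, rfl, ⟨hk⟩⟩ := hgen X
  have hn : Nonempty P.J := by
    obtain ⟨j, -⟩ := hdir ∅ (by simpa using hκ.pos)
    exact ⟨j⟩
  have hd : IsDirected P.J (· ≤ ·) := by
    refine ⟨fun x y => ?_⟩
    obtain ⟨j, hj⟩ := hdir {x, y}
      ((Cardinal.lt_aleph0_iff_set_finite.2 (Set.toFinite _)).trans_le hκ.aleph0_le)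
    exact ⟨j, hj x (by simp), hj y (by simp)⟩
  obtain ⟨M, hM⟩ := ess (obj := obj) hdc hmono hd hn D k hk
    (fun j => ⟨equivShrink S ⟨D.obj j, hD j⟩, ⟨eqToIso (by simp [obj])⟩⟩)
    (fun a f => (hSp _ (Subtype.coe_prop _) P.J hdir D k hk).1 f)
  exact ⟨M, hM⟩

end Paper
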